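/- arXiv:2404.04024 — 2 statements merged into one kernel-verified Lean document; each statement's English description precedes it below -/
import Mathlib

section
/- Let (G,c) and (H,c') be BPEC-DAGs on the same vertex set V. If M(G,c) = M(H,c'), then G = H and the colorings c and c' induce the same partition of the edge set into color classes. That is, an edge-colored DAG is structurally identifiable within the class of BPEC-DAGs. -/
open Matrix

/-- Principal minor `|Σ_A|`: determinant of the submatrix with rows and columns `A`. -/
noncomputable def pminor {p : ℕ} {R : Type*} [CommRing R] (M : Matrix (Fin p) (Fin p) R)
    (A : Finset (Fin p)) : R :=
  (M.submatrix (fun a : {x // x ∈ A} => a.1) (fun a : {x // x ∈ A} => a.1)).det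

/-- Almost-principal minor `|Σ_{ij|K}| = |Σ_{{i}∪K, {j}∪K}|`: determinant of the submatrix
with rows `{i} ∪ K` and columns `{j} ∪ K`, where `i` is matched with `j` and the elements
of `K` are matched with themselves. -/
noncomputable def cminor {p : ℕ} {R : Type*} [CommRing R] (M : Matrix (Fin p) (Fin p) R)
    (i j : Fin p) (K : Finset (Fin p)) : R :=
  (M.submatrix (Sum.elim (fun _ : Unit => i) (fun k : {x // x ∈ K} => k.1))
               (Sum.elim (fun _ : Unit => j) (fun k : {x // x ∈ K} => k.1))).det

/-- The parametrization `φ_G(Ω,Λ) = (1-Λ)^{-T} Ω (1-Λ)⁻¹` of a Gaussian DAG model. -/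
noncomputable def phiG {p : ℕ} (W L : Matrix (Fin p) (Fin p) ℝ) : Matrix (Fin p) (Fin p) ℝ :=
  ((1 - L)⁻¹)ᵀ * W * (1 - L)⁻¹

/-- The parents `pa_G(j) = {k : (k,j) ∈ E}` of a vertex `j` in the DAG with edge set `E`. -/
def parents {p : ℕ} (E : Finset (Fin p × Fin p)) (j : Fin p) : Finset (Fin p) :=
  Finset.univ.filter (fun k => (k, j) ∈ E)

/-- A directed graph with edge set `E` is acyclic iff no vertex lies on a directed cycle. -/
def IsAcyclic {p : ℕ} (E : Finset (Fin p × Fin p)) : Prop :=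
  ∀ i : Fin p, ¬ Relation.TransGen (fun a b => (a, b) ∈ E) i i

/-- `j` lies in `de̅_G(i) = {i} ∪ de_G(i)`, the closure of the descendants of `i`. -/
def InDescClosure {p : ℕ} (E : Finset (Fin p × Fin p)) (i j : Fin p) : Prop :=
  j = i ∨ Relation.TransGen (fun a b => (a, b) ∈ E) i j

/-- The edge-colored Gaussian DAG model `M(G,c)` of an edge-colored DAG: each vertex has
its own (singleton) color class, so the error variances `ω` are unconstrained, while
`λ_{ij} = λ_{kℓ}` whenever `c(ij) = c(kℓ)`. -/
noncomputable def ecModel {p : ℕ} (E : Finset (Fin p × Fin p))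
    (cE : Fin p × Fin p → ℕ) : Set (Matrix (Fin p) (Fin p) ℝ) :=
  {S | ∃ (ω : Fin p → ℝ) (L : Matrix (Fin p) (Fin p) ℝ),
    (∀ v, 0 < ω v) ∧ (∀ a b, (a, b) ∉ E → L a b = 0) ∧
    (∀ e ∈ E, ∀ e' ∈ E, cE e = cE e' → L e.1 e.2 = L e'.1 e'.2) ∧
    S = phiG (Matrix.diagonal ω) L}

/-- A directed graph without directed cycles has no self-loops. -/
theorem IsAcyclic.ne {p : ℕ} {E : Finset (Fin p × Fin p)} (hE : IsAcyclic E) {i j : Fin p}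
    (h : (i, j) ∈ E) : i ≠ j := by
  rintro rfl
  exact hE i (Relation.TransGen.single h)

theorem IsAcyclic.mono {p : ℕ} {E F : Finset (Fin p × Fin p)} (hF : IsAcyclic F) (h : E ⊆ F) :
    IsAcyclic E :=
  fun i hi => hF i (Relation.TransGen.mono (fun a b (hab : (a, b) ∈ E) => h hab) i i hi)

/-- The ancestor relation of a finite acyclic directed graph is well-founded. -/
theorem IsAcyclic.wellFounded {p : ℕ} {E : Finset (Fin p × Fin p)} (hE : IsAcyclic E) :
    WellFounded (Relation.TransGen fun a b => (a, b) ∈ E) :=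
  haveI : IsTrans (Fin p) (Relation.TransGen fun a b => (a, b) ∈ E) :=
    ⟨fun _ _ _ => Relation.TransGen.trans⟩
  haveI : Std.Irrefl (Relation.TransGen fun a b => (a, b) ∈ E) := ⟨hE⟩
  Finite.wellFounded_of_trans_of_irrefl _

/-- The descendant relation of a finite acyclic directed graph is well-founded. -/
theorem IsAcyclic.wellFounded_swap {p : ℕ} {E : Finset (Fin p × Fin p)} (hE : IsAcyclic E) :
    WellFounded fun a b => Relation.TransGen (fun a b => (a, b) ∈ E) b a :=
  haveI : IsTrans (Fin p) fun a b => Relation.TransGen (fun a b => (a, b) ∈ E) b a :=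
    ⟨fun _ _ _ h h' => Relation.TransGen.trans h' h⟩
  haveI : Std.Irrefl fun a b => Relation.TransGen (fun a b => (a, b) ∈ E) b a := ⟨hE⟩
  Finite.wellFounded_of_trans_of_irrefl _

/-- A nonempty acyclic edge set has an edge pointing to a sink. -/
theorem IsAcyclic.exists_edge_to_sink {p : ℕ} {E : Finset (Fin p × Fin p)} (hE : IsAcyclic E)
    (hne : E.Nonempty) : ∃ i j, (i, j) ∈ E ∧ ∀ k, (j, k) ∉ E := by
  obtain ⟨⟨a, b⟩, hab⟩ := hne
  obtain ⟨j, ⟨i, hij⟩, hmin⟩ := hE.wellFounded_swap.has_min {j | ∃ i, (i, j) ∈ E} ⟨b, a, hab⟩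
  exact ⟨i, j, hij, fun k hk => hmin k ⟨j, hk⟩ (Relation.TransGen.single hk)⟩

theorem isUnit_det_one_sub {p : ℕ} {E : Finset (Fin p × Fin p)} (hE : IsAcyclic E)
    {L : Matrix (Fin p) (Fin p) ℝ} (hL : ∀ a b, (a, b) ∉ E → L a b = 0) :
    IsUnit (1 - L).det := by
  rw [isUnit_iff_ne_zero]
  intro hdet
  obtain ⟨v, hv, h⟩ := Matrix.exists_vecMul_eq_zero_iff.mpr hdet
  apply hv
  funext j
  induction j using hE.wellFounded.induction with
  | _ j ih =>
    have hj := congrFun h j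
    rw [Matrix.vecMul_sub, Matrix.vecMul_one, Pi.sub_apply, Pi.zero_apply, sub_eq_zero] at hj
    rw [hj, Matrix.vecMul, dotProduct, Pi.zero_apply]
    refine Finset.sum_eq_zero fun i _ => ?_
    by_cases hij : (i, j) ∈ E
    · rw [ih i (Relation.TransGen.single hij), Pi.zero_apply, zero_mul]
    · rw [hL i j hij, mul_zero]

/-- The concentration matrix `(1-Λ) Ω⁻¹ (1-Λ)ᵀ` is the inverse of `φ_G(Ω,Λ)`. -/
theorem inv_phiG {p : ℕ} {L : Matrix (Fin p) (Fin p) ℝ} (hL : IsUnit (1 - L).det)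
    {ω : Fin p → ℝ} (hω : ∀ v, 0 < ω v) :
    (phiG (Matrix.diagonal ω) L)⁻¹ = (1 - L) * Matrix.diagonal (fun v => (ω v)⁻¹) * (1 - L)ᵀ := by
  have hD : (Matrix.diagonal ω)⁻¹ = Matrix.diagonal (fun v => (ω v)⁻¹) := by
    apply Matrix.inv_eq_right_inv
    rw [Matrix.diagonal_mul_diagonal, ← Matrix.diagonal_one]
    congr 1
    funext v
    exact mul_inv_cancel₀ (hω v).ne'
  rw [phiG, Matrix.mul_inv_rev, Matrix.mul_inv_rev, Matrix.nonsing_inv_nonsing_inv _ hL,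
    ← Matrix.transpose_nonsing_inv, Matrix.nonsing_inv_nonsing_inv _ hL, hD, Matrix.mul_assoc]

theorem concentration_apply {p : ℕ} (L : Matrix (Fin p) (Fin p) ℝ) (d : Fin p → ℝ)
    (i j : Fin p) :
    ((1 - L) * Matrix.diagonal d * (1 - L)ᵀ : Matrix (Fin p) (Fin p) ℝ) i j =
      ∑ k, (1 - L) i k * d k * (1 - L) j k := by
  rw [Matrix.mul_apply]
  simp only [Matrix.mul_diagonal, Matrix.transpose_apply]

/-- The column of the concentration matrix at a sink `j` is a multiple of that of `1 - Λ`. -/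
theorem concentration_apply_of_sink {p : ℕ} {L : Matrix (Fin p) (Fin p) ℝ} (d : Fin p → ℝ)
    {j : Fin p} (hj : ∀ k, L j k = 0) (i : Fin p) :
    ((1 - L) * Matrix.diagonal d * (1 - L)ᵀ : Matrix (Fin p) (Fin p) ℝ) i j = (1 - L) i j * d j := by
  rw [concentration_apply, Finset.sum_eq_single j]
  · simp [hj]
  · intro k _ hk
    simp [hj, Matrix.one_apply_ne hk.symm]
  · simp

/-- At a common sink `j`, column `j` of `Λ` is determined by the covariance matrix. -/
theorem apply_sink_eq_of_phiG_eq {p : ℕ} {L L' : Matrix (Fin p) (Fin p) ℝ}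
    (hL : IsUnit (1 - L).det) (hL' : IsUnit (1 - L').det) {ω ω' : Fin p → ℝ}
    (hω : ∀ v, 0 < ω v) (hω' : ∀ v, 0 < ω' v)
    (h : phiG (Matrix.diagonal ω) L = phiG (Matrix.diagonal ω') L') {j : Fin p}
    (hj : ∀ k, L j k = 0) (hj' : ∀ k, L' j k = 0) (i : Fin p) : L i j = L' i j := by
  have hK := congrArg (·⁻¹) h
  simp only [inv_phiG hL hω, inv_phiG hL' hω'] at hK
  have hKij := congrFun (congrFun hK i) j
  have hKjj := congrFun (congrFun hK j) j
  simp only [concentration_apply_of_sink _ hj, concentration_apply_of_sink _ hj'] at hKij hKjj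
  simp only [Matrix.sub_apply, hj, hj', Matrix.one_apply_eq, sub_zero, one_mul] at hKjj
  rw [hKjj] at hKij
  have := mul_right_cancel₀ (inv_pos.mpr (hω' j)).ne' hKij
  simpa using this

/-- If a BPEC-DAG model contains a blocked edge-colored model, then each of its sinks is a sink
of the smaller model's graph. -/
theorem sink_of_ecModel_subset {p : ℕ} {E F : Finset (Fin p × Fin p)} (hE : IsAcyclic E)
    (hF : IsAcyclic F) {cE dE : Fin p × Fin p → ℕ}
    (hEblocked : ∀ e ∈ E, ∀ e' ∈ E, cE e = cE e' → e.2 = e'.2)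
    (hFblocked : ∀ e ∈ F, ∀ e' ∈ F, dE e = dE e' → e.2 = e'.2)
    (hFproper : ∀ e ∈ F, ∃ e' ∈ F, e' ≠ e ∧ dE e' = dE e)
    (hsub : ecModel E cE ⊆ ecModel F dE) {j : Fin p} (hj : ∀ k, (j, k) ∉ F) (k : Fin p) :
    (j, k) ∉ E := by
  classical
  intro hjk
  have hne : j ≠ k := hE.ne hjk
  let L : Matrix (Fin p) (Fin p) ℝ :=
    fun a b => if (a, b) ∈ E ∧ cE (a, b) = cE (j, k) then 1 else 0
  have hLsupp : ∀ a b, (a, b) ∉ E → L a b = 0 := fun a b h => if_neg fun h' => h h'.1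
  have hLcol : ∀ a b, b ≠ k → L a b = 0 :=
    fun a b hb => if_neg fun h => hb (hEblocked _ h.1 _ hjk h.2)
  have hLjk : L j k = 1 := if_pos ⟨hjk, rfl⟩
  have hLnonneg : ∀ a b, 0 ≤ L a b := by
    intro a b
    change 0 ≤ ite _ _ _
    split_ifs <;> norm_num
  obtain ⟨ω, L', hω, hL'supp, hL'color, hS⟩ := hsub (show phiG (Matrix.diagonal fun _ => 1) L ∈
      ecModel E cE from ⟨fun _ => 1, L, fun _ => one_pos, hLsupp, fun e he e' he' hc => by
        simp [L, he, he', hc], rfl⟩)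
  have hK := congrArg (·⁻¹) hS
  simp only [inv_phiG (isUnit_det_one_sub hE hLsupp) fun _ => one_pos,
    inv_phiG (isUnit_det_one_sub hF hL'supp) hω] at hK
  have hcol : ∀ i, (1 - L) i j - (1 - L) i k = (1 - L') i j * (ω j)⁻¹ := by
    intro i
    rw [← concentration_apply_of_sink (fun v => (ω v)⁻¹) (fun m => hL'supp j m (hj m)), ← hK,
      concentration_apply, ← Finset.sum_subset (Finset.subset_univ {j, k})]
    · rw [Finset.sum_pair hne]
      simp [hLcol j j hne, hLjk, Matrix.one_apply_ne hne]
      ring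
    · intro m _ hm
      simp only [Finset.mem_insert, Finset.mem_singleton, not_or] at hm
      simp [hLcol j m hm.2, Matrix.one_apply_ne (Ne.symm hm.1)]
  have hentry : ∀ i, i ≠ j → L' i j * (ω j)⁻¹ = (1 : Matrix (Fin p) (Fin p) ℝ) i k - L i k := by
    intro i hi
    have := hcol i
    simp only [Matrix.sub_apply, Matrix.one_apply_ne hi, hLcol i j hne] at this
    linarith
  have hk := hentry k hne.symm
  rw [hLsupp k k fun h => hE.ne h rfl, Matrix.one_apply_eq, sub_zero] at hk
  have hkF : (k, j) ∈ F := by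
    by_contra h
    rw [hL'supp k j h, zero_mul] at hk
    exact zero_ne_one hk
  obtain ⟨⟨k', j'⟩, hk'F, hk'ne, hcolor⟩ := hFproper _ hkF
  obtain rfl : j' = j := hFblocked _ hk'F _ hkF hcolor
  have hk' := hentry k' (hF.ne hk'F)
  rw [Matrix.one_apply_ne fun h => hk'ne (by rw [h]), hL'color _ hk'F _ hkF hcolor, hk] at hk'
  linarith [hLnonneg k' k]

/-- At a common sink, inclusion of models gives inclusion of the incoming edges and refinement of
their coloring. -/
theorem edges_to_sink_of_ecModel_subset {p : ℕ} {E F : Finset (Fin p × Fin p)} (hE : IsAcyclic E)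
    (hF : IsAcyclic F) {cE dE : Fin p × Fin p → ℕ} (hsub : ecModel E cE ⊆ ecModel F dE)
    (hEblocked : ∀ e ∈ E, ∀ e' ∈ E, cE e = cE e' → e.2 = e'.2)
    {j : Fin p} (hjE : ∀ k, (j, k) ∉ E) (hjF : ∀ k, (j, k) ∉ F) :
    (∀ i, (i, j) ∈ E → (i, j) ∈ F) ∧
      ∀ i i', (i, j) ∈ E → (i', j) ∈ E → dE (i, j) = dE (i', j) → cE (i, j) = cE (i', j) := by
  classical
  let L : Matrix (Fin p) (Fin p) ℝ :=
    fun a b => if (a, b) ∈ E ∧ b = j then (cE (a, b) : ℝ) + 1 else 0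
  have hLsupp : ∀ a b, (a, b) ∉ E → L a b = 0 := fun a b h => if_neg fun h' => h h'.1
  have hLj : ∀ i, (i, j) ∈ E → L i j = (cE (i, j) : ℝ) + 1 := fun i hi => if_pos ⟨hi, rfl⟩
  obtain ⟨ω, L', hω, hL'supp, hL'color, hS⟩ := hsub (show phiG (Matrix.diagonal fun _ => 1) L ∈
      ecModel E cE from ⟨fun _ => 1, L, fun _ => one_pos, hLsupp, fun e he e' he' hc => by
        simp only [L, Prod.mk.eta, he, he', hc, true_and]
        rw [hEblocked e he e' he' hc], rfl⟩)
  have heq : ∀ i, L i j = L' i j :=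
    apply_sink_eq_of_phiG_eq (isUnit_det_one_sub hE hLsupp) (isUnit_det_one_sub hF hL'supp)
      (fun _ => one_pos) hω hS (fun k => hLsupp j k (hjE k)) (fun k => hL'supp j k (hjF k))
  have hmem : ∀ i, (i, j) ∈ E → (i, j) ∈ F := by
    intro i hi
    by_contra h
    have := heq i
    rw [hL'supp i j h, hLj i hi] at this
    exact (Nat.cast_add_one_ne_zero _) this
  refine ⟨hmem, fun i i' hi hi' hd => ?_⟩
  have := hL'color _ (hmem i hi) _ (hmem i' hi') hd
  simp only [← heq, hLj i hi, hLj i' hi'] at this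
  exact_mod_cast add_right_cancel this

/-- Inclusion of models is preserved by deleting all edges into a common sink. -/
theorem ecModel_filter_subset {p : ℕ} {E F : Finset (Fin p × Fin p)} (hE : IsAcyclic E)
    (hF : IsAcyclic F) {cE dE : Fin p × Fin p → ℕ} (hsub : ecModel E cE ⊆ ecModel F dE)
    (hEblocked : ∀ e ∈ E, ∀ e' ∈ E, cE e = cE e' → e.2 = e'.2)
    {j : Fin p} (hjE : ∀ k, (j, k) ∉ E) (hjF : ∀ k, (j, k) ∉ F) :
    ecModel (E.filter fun e => e.2 ≠ j) cE ⊆ ecModel (F.filter fun e => e.2 ≠ j) dE := by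
  rintro S ⟨ω, L, hω, hLsupp, hLcolor, hS⟩
  have hLsupp' : ∀ a b, (a, b) ∉ E → L a b = 0 :=
    fun a b h => hLsupp a b fun h' => h (Finset.mem_filter.mp h').1
  have hLj : ∀ a, L a j = 0 := fun a => hLsupp a j fun h => (Finset.mem_filter.mp h).2 rfl
  obtain ⟨ω', L', hω', hL'supp, hL'color, hS'⟩ := hsub (show S ∈ ecModel E cE from
    ⟨ω, L, hω, hLsupp', fun e he e' he' hc => by
      have h2 := hEblocked e he e' he' hc
      by_cases h : e.2 = j
      · rw [← h2, h, hLj, hLj]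
      · exact hLcolor e (Finset.mem_filter.mpr ⟨he, h⟩) e'
          (Finset.mem_filter.mpr ⟨he', h2 ▸ h⟩) hc, hS⟩)
  have heq : ∀ i, L i j = L' i j :=
    apply_sink_eq_of_phiG_eq (isUnit_det_one_sub hE hLsupp') (isUnit_det_one_sub hF hL'supp)
      hω hω' (hS ▸ hS') (fun k => hLsupp' j k (hjE k)) (fun k => hL'supp j k (hjF k))
  refine ⟨ω', L', hω', fun a b hab => ?_, fun e he e' he' hc => ?_, hS'⟩
  · by_cases hb : b = j
    · rw [hb, ← heq, hLj]
    · exact hL'supp a b fun h => hab (Finset.mem_filter.mpr ⟨h, hb⟩)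
  · exact hL'color e (Finset.mem_filter.mp he).1 e' (Finset.mem_filter.mp he').1 hc

/-- Deleting all edges into a vertex keeps a blocked and properly colored graph properly
colored. -/
theorem proper_filter {p : ℕ} {E : Finset (Fin p × Fin p)} {c : Fin p × Fin p → ℕ}
    (hblocked : ∀ e ∈ E, ∀ e' ∈ E, c e = c e' → e.2 = e'.2)
    (hproper : ∀ e ∈ E, ∃ e' ∈ E, e' ≠ e ∧ c e' = c e) (j : Fin p) :
    ∀ e ∈ E.filter (fun e => e.2 ≠ j), ∃ e' ∈ E.filter (fun e => e.2 ≠ j),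
      e' ≠ e ∧ c e' = c e := by
  intro e he
  obtain ⟨heE, hej⟩ := Finset.mem_filter.mp he
  obtain ⟨e', he'E, hne, hc⟩ := hproper e heE
  exact ⟨e', Finset.mem_filter.mpr ⟨he'E, hblocked e' he'E e heE hc ▸ hej⟩, hne, hc⟩

/-- Structural identifiability of BPEC-DAGs.
Let `(G,c)` and `(H,c')` be BPEC-DAGs (blocked: same-colored edges point to the same
vertex; properly colored: every edge color class contains at least two edges) on the
same vertex set.  If `M(G,c) = M(H,c')`, then `G = H` and the two colorings induce the
same partition of the edge set into color classes. -/
theorem bpec_identifiable {p : ℕ}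
    (E F : Finset (Fin p × Fin p)) (hE : IsAcyclic E) (hF : IsAcyclic F)
    (cE dE : Fin p × Fin p → ℕ)
    (hEblocked : ∀ e ∈ E, ∀ e' ∈ E, cE e = cE e' → e.2 = e'.2)
    (hEproper : ∀ e ∈ E, ∃ e' ∈ E, e' ≠ e ∧ cE e' = cE e)
    (hFblocked : ∀ e ∈ F, ∀ e' ∈ F, dE e = dE e' → e.2 = e'.2)
    (hFproper : ∀ e ∈ F, ∃ e' ∈ F, e' ≠ e ∧ dE e' = dE e)
    (hmodels : ecModel E cE = ecModel F dE) :
    E = F ∧ ∀ e ∈ E, ∀ e' ∈ E, (cE e = cE e' ↔ dE e = dE e') := by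
  induction hn : E.card using Nat.strong_induction_on generalizing E F with
  | _ n ih =>
    rcases E.eq_empty_or_nonempty with rfl | hne
    · have hFempty : F = ∅ := by
        refine Finset.eq_empty_of_forall_notMem fun e he => ?_
        exact sink_of_ecModel_subset hF hE hFblocked hEblocked hEproper hmodels.ge
          (j := e.1) (fun _ => Finset.notMem_empty _) e.2 he
      exact ⟨hFempty.symm, fun e he => absurd he (Finset.notMem_empty e)⟩
    · obtain ⟨i, j, hij, hjE⟩ := hE.exists_edge_to_sink hne
      have hjF : ∀ k, (j, k) ∉ F :=
        sink_of_ecModel_subset hF hE hFblocked hEblocked hEproper hmodels.ge hjE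
      obtain ⟨hEF, hdc⟩ :=
        edges_to_sink_of_ecModel_subset hE hF hmodels.le hEblocked hjE hjF
      obtain ⟨hFE, hcd⟩ :=
        edges_to_sink_of_ecModel_subset hF hE hmodels.ge hFblocked hjF hjE
      have hlt : (E.filter fun e => e.2 ≠ j).card < n := by
        rw [← hn]
        exact Finset.card_lt_card (Finset.filter_ssubset.mpr ⟨(i, j), hij, fun h => h rfl⟩)
      obtain ⟨hfilter, hcolor⟩ := ih _ hlt
        (E.filter fun e => e.2 ≠ j) (F.filter fun e => e.2 ≠ j)
        (hE.mono (Finset.filter_subset _ _)) (hF.mono (Finset.filter_subset _ _))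
        (fun e he e' he' => hEblocked e (Finset.mem_filter.mp he).1 e' (Finset.mem_filter.mp he').1)
        (proper_filter hEblocked hEproper j)
        (fun e he e' he' => hFblocked e (Finset.mem_filter.mp he).1 e' (Finset.mem_filter.mp he').1)
        (proper_filter hFblocked hFproper j)
        ((ecModel_filter_subset hE hF hmodels.le hEblocked hjE hjF).antisymm
          (ecModel_filter_subset hF hE hmodels.ge hFblocked hjF hjE)) rfl
      have hEeqF : E = F := by
        ext ⟨a, b⟩
        by_cases hb : b = j
        · subst hb
          exact ⟨hEF a, hFE a⟩
        · have := Finset.ext_iff.mp hfilter (a, b)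
          simpa [hb] using this
      refine ⟨hEeqF, ?_⟩
      subst hEeqF
      rintro ⟨a, b⟩ he ⟨a', b'⟩ he'
      by_cases hbb : b = b'
      · subst hbb
        by_cases hb : b = j
        · subst hb
          exact ⟨hcd a a' he he', hdc a a' he he'⟩
        · exact hcolor _ (Finset.mem_filter.mpr ⟨he, hb⟩) _ (Finset.mem_filter.mpr ⟨he', hb⟩)
      · exact ⟨fun h => absurd (hEblocked _ he _ he' h) hbb,
          fun h => absurd (hFblocked _ he _ he' h) hbb⟩
end

section
/- Let G and H be DAGs on the same vertex set V with the same skeleton and the same v-structures (i.e., Markov-equivalent DAGs). Suppose j is a sink node of G but not a sink node of H, that H contains at least two edges, among them an edge jℓ, and that for every edge ik of H with (i,k) ≠ (j,ℓ) one has j ∈ pa_H(k). Then j is a source node of H, the connected component of the skeleton of H containing j induces a complete graph (any two of its vertices are adjacent in H), and every other connected component of H is an isolated vertex. -/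
open Matrix

/-- `i` and `j` are adjacent in the DAG with edge set `E` (this gives the skeleton). -/
def Adjacent {p : ℕ} (E : Finset (Fin p × Fin p)) (i j : Fin p) : Prop :=
  (i, j) ∈ E ∨ (j, i) ∈ E

/-- Structure lemma for Markov-equivalent DAGs.
Let `G` and `H` be DAGs on the same vertex set with the same skeleton and the same
v-structures.  Suppose `j` is a sink node of `G` but not of `H`, that `H` has at least
two edges, among them an edge `jℓ`, and that every edge `ik` of `H` other than `jℓ`
satisfies `j ∈ pa_H(k)`.  Then `j` is a source node of `H`, the connected component of
the skeleton of `H` containing `j` induces a complete graph, and every other connected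
component of `H` is an isolated vertex. -/
theorem sink_covered_structure {p : ℕ}
    (E F : Finset (Fin p × Fin p)) (hE : IsAcyclic E) (hF : IsAcyclic F)
    (hskel : ∀ a b : Fin p, Adjacent E a b ↔ Adjacent F a b)
    (hvstruct : ∀ a b v : Fin p,
      (a ≠ b ∧ (a, v) ∈ E ∧ (b, v) ∈ E ∧ ¬ Adjacent E a b) ↔
      (a ≠ b ∧ (a, v) ∈ F ∧ (b, v) ∈ F ∧ ¬ Adjacent F a b))
    (j l : Fin p)
    (hsinkG : ∀ k, (j, k) ∉ E)
    (hjl : (j, l) ∈ F) (hcard : 2 ≤ F.card)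
    (hall : ∀ e ∈ F, e ≠ (j, l) → (j, e.2) ∈ F) :
    (∀ a, (a, j) ∉ F) ∧
    (∀ u v : Fin p,
      Relation.ReflTransGen (Adjacent F) j u → Relation.ReflTransGen (Adjacent F) j v →
      u ≠ v → Adjacent F u v) ∧
    (∀ u : Fin p, ¬ Relation.ReflTransGen (Adjacent F) j u → ∀ v, ¬ Adjacent F u v) := by
  have hchild : ∀ a b, (a, b) ∈ F → (j, b) ∈ F := fun a b hab => by
    by_cases h : (a, b) = (j, l)
    · obtain ⟨-, rfl⟩ := Prod.mk.inj h
      exact hjl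
    · exact hall _ hab h
  have hsrc : ∀ a, (a, j) ∉ F := fun a ha => hF j (.single (hchild a j ha))
  have hnbr : ∀ u, Adjacent F u j → (u, j) ∈ E := fun u hu =>
    ((hskel u j).2 hu).resolve_right (hsinkG u)
  have htail : ∀ a b, (a, b) ∈ F → a ≠ j → Adjacent F a j := fun a b hab ha => by
    by_contra hn
    exact hsinkG b ((hvstruct a j b).2 ⟨ha, hab, hchild a b hab, hn⟩).2.2.1
  have hadj : ∀ u v, Adjacent F u v → u = j ∨ Adjacent F u j := fun u v huv => by
    rcases huv with h | h
    · exact or_iff_not_imp_left.2 (htail u v h)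
    · exact .inr (.inr (hchild v u h))
  have hreach : ∀ u, Relation.ReflTransGen (Adjacent F) j u → u = j ∨ Adjacent F u j :=
    fun u hu => by
      rcases hu.cases_tail with h | ⟨w, -, hw⟩
      · exact .inl h
      · exact hadj u w hw.symm
  refine ⟨hsrc, fun u v hu hv huv => ?_, fun u hu v huv => hu ?_⟩
  · rcases hreach u hu with rfl | hu'
    · exact ((hreach v hv).resolve_left huv.symm).symm
    rcases hreach v hv with rfl | hv'
    · exact hu'
    by_contra hn
    exact hsrc u ((hvstruct u v j).1
      ⟨huv, hnbr u hu', hnbr v hv', fun h => hn ((hskel u v).1 h)⟩).2.1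
  · rcases hadj u v huv with rfl | h
    · exact .refl
    · exact .single h.symm
end
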